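/- Let V be a finite set with symmetric weights w, T a maximum spanning tree of the complete graph on V, and χ a proper 2-coloring of T. For any 2-coloring φ of V, define diam(φ) as the maximum of w(uv) over all pairs u ≠ v with φ(u) = φ(v), and M(φ) as the maximum of w(xy) over φ-monochromatic edges xy of T (both −∞ if no such pair exists). Then diam(φ) = max(diam(χ), M(φ)). -/

import Mathlib

open SimpleGraph

/-- Total weight of a graph's edges. -/
noncomputable def edgeWeightSum {V : Type*} [Fintype V] (w : Sym2 V → ℝ)
    (G : SimpleGraph V) : ℝ :=
  ∑ e ∈ G.edgeSet.toFinite.toFinset, w e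

/-- `pdiam w φ` : the partition diameter of the 2-coloring `φ`, i.e. the maximum
weight over `φ`-monochromatic pairs of distinct vertices (`⊥` if none). -/
noncomputable def pdiam {V : Type*} [Fintype V] [DecidableEq V]
    (w : Sym2 V → ℝ) (φ : V → Fin 2) : EReal :=
  Finset.sup (Finset.univ.filter fun uv : V × V => uv.1 ≠ uv.2 ∧ φ uv.1 = φ uv.2)
    fun uv => (w s(uv.1, uv.2) : EReal)

/-- `treeM w T φ` : the maximum weight over `φ`-monochromatic edges of `T`
(`⊥` if none). -/
noncomputable def treeM {V : Type*} [Fintype V] [DecidableEq V]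
    (w : Sym2 V → ℝ) (T : SimpleGraph V) [DecidableRel T.Adj] (φ : V → Fin 2) : EReal :=
  Finset.sup (Finset.univ.filter fun uv : V × V => T.Adj uv.1 uv.2 ∧ φ uv.1 = φ uv.2)
    fun uv => (w s(uv.1, uv.2) : EReal)

/-- Two 2-colorings that are both proper along a walk agree on whether its endpoints match. -/
theorem SimpleGraph.Walk.coloring_eq_iff {V : Type*} {G : SimpleGraph V} {χ φ : V → Fin 2}
    {u v : V} (p : G.Walk u v) (hχ : ∀ a b, s(a, b) ∈ p.edges → χ a ≠ χ b)
    (hφ : ∀ a b, s(a, b) ∈ p.edges → φ a ≠ φ b) : χ u = χ v ↔ φ u = φ v := by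
  induction p with
  | nil => simp
  | @cons a b c h p ih =>
    have hp := ih (fun x y hxy ↦ hχ x y (by simp [hxy])) (fun x y hxy ↦ hφ x y (by simp [hxy]))
    have h₁ := hχ a b (by simp)
    have h₂ := hφ a b (by simp)
    omega

/-- Deleting an edge on the path between two vertices of an acyclic graph separates them. -/
theorem SimpleGraph.IsAcyclic.not_reachable_deleteEdges {V : Type*} {G : SimpleGraph V}
    (hG : G.IsAcyclic) {u v : V} {p : G.Walk u v} (hp : p.IsPath) {e : Sym2 V}
    (he : e ∈ p.edges) : ¬ (G.deleteEdges {e}).Reachable u v := by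
  intro hr
  obtain ⟨q, hq⟩ := hr.exists_isPath
  have hqp : q.mapLe (G.deleteEdges_le {e}) = p :=
    congrArg Subtype.val
      ((hG.subsingleton_path u v).elim ⟨_, hq.mapLe (G.deleteEdges_le {e})⟩ ⟨p, hp⟩)
  rw [← hqp, Walk.edges_mapLe_eq_edges] at he
  have := q.edges_subset_edgeSet he
  simp at this

/-- Exchanging an edge on the path between `u` and `v` in a tree for the edge `uv` gives a tree. -/
theorem SimpleGraph.IsTree.exchange {V : Type*} [Finite V] {T : SimpleGraph V} (hT : T.IsTree)
    {u v : V} (huv : u ≠ v) {p : T.Walk u v} (hp : p.IsPath) {e : Sym2 V} (he : e ∈ p.edges) :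
    (T.deleteEdges {e} ⊔ edge u v).IsTree := by
  have hr := hT.isAcyclic.not_reachable_deleteEdges hp he
  have hac := (hT.isAcyclic.anti (T.deleteEdges_le {e})).sup_edge_of_not_reachable hr
  have hset : (T.deleteEdges {e} ⊔ edge u v).edgeSet = insert s(u, v) (T.edgeSet \ {e}) := by
    rw [edgeSet_sup, edgeSet_edge_of_ne huv, edgeSet_deleteEdges, Set.union_singleton]
  have hcard : (T.deleteEdges {e} ⊔ edge u v).edgeSet.ncard = T.edgeSet.ncard := by
    have hnot : s(u, v) ∉ T.edgeSet \ {e} := fun h ↦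
      hr (Adj.reachable (by simpa using h))
    rw [hset, Set.ncard_insert_of_notMem hnot,
      Set.ncard_sdiff_singleton_add_one (p.edges_subset_edgeSet he)]
  have := hT.nonempty
  obtain ⟨F, hle, -, hF⟩ := connected_top.exists_isTree_le_of_le_of_isAcyclic le_top hac
  have hFcard : F.edgeSet.ncard = T.edgeSet.ncard := by
    have h₁ := (isTree_iff_connected_and_card.mp hF).2
    have h₂ := (isTree_iff_connected_and_card.mp hT).2
    rw [Nat.card_coe_set_eq] at h₁ h₂
    omega
  have heq := Set.eq_of_subset_of_ncard_le (edgeSet_mono hle) (hFcard.trans hcard.symm).le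
  rwa [edgeSet_inj.mp heq]

/-- In a maximum spanning tree, an edge on the path from `u` to `v` weighs at least `w s(u, v)`. -/
theorem weight_le_of_mem_path_edges {V : Type*} [Fintype V] {w : Sym2 V → ℝ}
    {T : SimpleGraph V} (hT : T.IsTree)
    (hmax : ∀ T' : SimpleGraph V, T'.IsTree → edgeWeightSum w T' ≤ edgeWeightSum w T)
    {u v : V} (huv : u ≠ v) {p : T.Walk u v} (hp : p.IsPath) {e : Sym2 V} (he : e ∈ p.edges) :
    w s(u, v) ≤ w e := by
  classical
  have hr := hT.isAcyclic.not_reachable_deleteEdges hp he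
  have hle := hmax _ (hT.exchange huv hp he)
  have hset : (T.deleteEdges {e} ⊔ edge u v).edgeSet.toFinite.toFinset =
      insert s(u, v) (T.edgeSet.toFinite.toFinset.erase e) := by
    ext x
    simp only [edgeSet_sup, edgeSet_edge_of_ne huv, edgeSet_deleteEdges, Set.Finite.mem_toFinset,
      Set.mem_union, Set.mem_sdiff, Set.mem_singleton_iff, Finset.mem_insert, Finset.mem_erase]
    tauto
  have hnot : s(u, v) ∉ T.edgeSet.toFinite.toFinset.erase e := by
    intro h
    apply hr
    apply Adj.reachable
    simpa [and_comm, eq_comm] using h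
  have hmem : e ∈ T.edgeSet.toFinite.toFinset := by
    simpa using p.edges_subset_edgeSet he
  rw [edgeWeightSum, edgeWeightSum, hset, Finset.sum_insert hnot,
    ← Finset.add_sum_erase _ _ hmem] at hle
  linarith

/-- If two colorings disagree on whether `u` and `v` match, the first being proper on a maximum
spanning tree, then some tree edge that is monochromatic for the second weighs at least
`w s(u, v)`. -/
theorem exists_monochromatic_adj_weight_le {V : Type*} [Fintype V] {w : Sym2 V → ℝ}
    {T : SimpleGraph V} (hT : T.IsTree)
    (hmax : ∀ T' : SimpleGraph V, T'.IsTree → edgeWeightSum w T' ≤ edgeWeightSum w T)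
    {χ φ : V → Fin 2} (hχ : ∀ a b, T.Adj a b → χ a ≠ χ b) {u v : V} (huv : u ≠ v)
    (h : ¬ (χ u = χ v ↔ φ u = φ v)) :
    ∃ a b, T.Adj a b ∧ φ a = φ b ∧ w s(u, v) ≤ w s(a, b) := by
  obtain ⟨p, hp⟩ := hT.connected.exists_isPath u v
  by_contra! hcon
  refine h (p.coloring_eq_iff (fun a b hab ↦ hχ a b (p.edges_subset_edgeSet hab))
    fun a b hab hφ ↦ ?_)
  exact (hcon a b (p.edges_subset_edgeSet hab) hφ).not_ge
    (weight_le_of_mem_path_edges hT hmax huv hp hab)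

theorem weight_le_pdiam {V : Type*} [Fintype V] [DecidableEq V] (w : Sym2 V → ℝ)
    {φ : V → Fin 2} {u v : V} (huv : u ≠ v) (h : φ u = φ v) :
    (w s(u, v) : EReal) ≤ pdiam w φ :=
  Finset.le_sup (f := fun uv : V × V => (w s(uv.1, uv.2) : EReal)) (b := (u, v))
    (by simp [huv, h])

theorem weight_le_treeM {V : Type*} [Fintype V] [DecidableEq V] (w : Sym2 V → ℝ)
    {T : SimpleGraph V} [DecidableRel T.Adj] {φ : V → Fin 2} {u v : V} (huv : T.Adj u v)
    (h : φ u = φ v) : (w s(u, v) : EReal) ≤ treeM w T φ :=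
  Finset.le_sup (f := fun uv : V × V => (w s(uv.1, uv.2) : EReal)) (b := (u, v))
    (by simp [huv, h])

/-- Decomposition identity: for a maximum spanning tree `T` with proper
2-coloring `χ`, every 2-coloring `φ` satisfies
`diam(φ) = max (diam(χ)) (M(φ))`. -/
theorem stmt_4 {V : Type*} [Fintype V] [DecidableEq V] (w : Sym2 V → ℝ)
    (T : SimpleGraph V) [DecidableRel T.Adj] (hT : T.IsTree)
    (hmax : ∀ T' : SimpleGraph V, T'.IsTree → edgeWeightSum w T' ≤ edgeWeightSum w T)
    (χ : V → Fin 2) (hχ : ∀ a b, T.Adj a b → χ a ≠ χ b)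
    (φ : V → Fin 2) :
    pdiam w φ = max (pdiam w χ) (treeM w T φ) := by
  apply le_antisymm
  · refine Finset.sup_le fun ⟨u, v⟩ huv ↦ ?_
    obtain ⟨hne, hφ⟩ : u ≠ v ∧ φ u = φ v := by simpa using huv
    by_cases h : χ u = χ v
    · exact le_max_of_le_left (weight_le_pdiam w hne h)
    · obtain ⟨a, b, hab, hφab, hle⟩ :=
        exists_monochromatic_adj_weight_le (φ := φ) hT hmax hχ hne (by tauto)
      exact le_max_of_le_right
        ((EReal.coe_le_coe_iff.mpr hle).trans (weight_le_treeM w hab hφab))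
  · refine max_le (Finset.sup_le fun ⟨u, v⟩ huv ↦ ?_) (Finset.sup_le fun ⟨u, v⟩ huv ↦ ?_)
    · obtain ⟨hne, hχuv⟩ : u ≠ v ∧ χ u = χ v := by simpa using huv
      by_cases h : φ u = φ v
      · exact weight_le_pdiam w hne h
      · obtain ⟨a, b, hab, hφab, hle⟩ :=
          exists_monochromatic_adj_weight_le (φ := φ) hT hmax hχ hne (by tauto)
        exact (EReal.coe_le_coe_iff.mpr hle).trans (weight_le_pdiam w hab.ne hφab)
    · obtain ⟨hadj, hφ⟩ : T.Adj u v ∧ φ u = φ v := by simpa using huv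
      exact weight_le_pdiam w hadj.ne hφ
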